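/- Any nondisturbing measurement by the first party is trivial on the 2p−1 states: if ⟨ψ_k, (B ⊗ I_n) ψ_l⟩ = 0 for all k, l with 1 ≤ k, l ≤ 2p−1 and k ≠ l, then ⟨ψ_k, (B ⊗ I_n) ψ_k⟩ = B_{00} for every k with 1 ≤ k ≤ 2p−1; in particular all 2p−1 outcome probabilities are equal. -/

import Mathlib

open scoped ComplexInnerProductSpace Kronecker ComplexOrder

/-- The `i`-th standard basis vector `|i⟩` of `ℂ^m` (zero if `i ≥ m`). -/
noncomputable def ket (m i : ℕ) : EuclideanSpace ℂ (Fin m) :=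
  (WithLp.equiv 2 (Fin m → ℂ)).symm fun a => if (a : ℕ) = i then 1 else 0

/-- The product state `v ⊗ w`, with entries `(v ⊗ w)_{(a,b)} = v_a * w_b`. -/
noncomputable def tp {m n : ℕ} (v : EuclideanSpace ℂ (Fin m)) (w : EuclideanSpace ℂ (Fin n)) :
    EuclideanSpace ℂ (Fin m × Fin n) :=
  (WithLp.equiv 2 (Fin m × Fin n → ℂ)).symm fun ab => v ab.1 * w ab.2

/-- The scalar `1/√2`. -/
noncomputable def invSqrt2 : ℂ := ((Real.sqrt 2)⁻¹ : ℝ)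

/-- A matrix on `ℂ^m ⊗ ℂ^n` acting as a linear map. -/
noncomputable def act {m n : ℕ} (M : Matrix (Fin m × Fin n) (Fin m × Fin n) ℂ)
    (x : EuclideanSpace ℂ (Fin m × Fin n)) : EuclideanSpace ℂ (Fin m × Fin n) :=
  Matrix.toEuclideanLin M x

/-- The index `j(i)`: `j(i) = i + 1` for `i ≤ p - 2`, and `j(p-1) = 1`. -/
def jf (p i : ℕ) : ℕ := if i = p - 1 then 1 else i + 1

/-- The unnormalized uniform superposition `|0⟩ + |1⟩ + ⋯ + |p-1⟩` in `ℂ^m`. -/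
noncomputable def unif (m p : ℕ) : EuclideanSpace ℂ (Fin m) :=
  ∑ i ∈ Finset.range p, ket m i

/-- The `2p-1` product states `ψ_k` (`1 ≤ k ≤ 2p-1`) of Theorem 2:
`ψ_i = |i⟩ ⊗ (|0⟩-|i⟩)/√2`, `ψ_{i+p-1} = (|0⟩-|i⟩)/√2 ⊗ |j(i)⟩` for `1 ≤ i ≤ p-1`,
and `ψ_{2p-1} = (1/p)(|0⟩+⋯+|p-1⟩) ⊗ (|0⟩+⋯+|p-1⟩)`. -/
noncomputable def psi2 (m n p k : ℕ) : EuclideanSpace ℂ (Fin m × Fin n) :=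
  if k ≤ p - 1 then tp (ket m k) (invSqrt2 • (ket n 0 - ket n k))
  else if k ≤ 2 * p - 2 then
    tp (invSqrt2 • (ket m 0 - ket m (k - (p - 1)))) (ket n (jf p (k - (p - 1))))
  else ((p : ℂ))⁻¹ • tp (unif m p) (unif n p)

theorem inner_tp_act_kronecker_one {m n : ℕ} (B : Matrix (Fin m) (Fin m) ℂ)
    (v v' : EuclideanSpace ℂ (Fin m)) (w w' : EuclideanSpace ℂ (Fin n)) :
    ⟪tp v w, act (B ⊗ₖ (1 : Matrix (Fin n) (Fin n) ℂ)) (tp v' w')⟫ =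
      ⟪v, Matrix.toEuclideanLin B v'⟫ * ⟪w, w'⟫ := by
  simp only [tp, act, PiLp.inner_apply, RCLike.inner_apply, Matrix.toLpLin_apply,
    Matrix.mulVec, dotProduct, Matrix.kroneckerMap_apply, Matrix.one_apply, Fintype.sum_prod_type,
    WithLp.equiv_symm_apply, map_mul, Finset.sum_mul_sum]
  refine Finset.sum_congr rfl fun a _ => Finset.sum_congr rfl fun b _ => ?_
  simp only [mul_ite, ite_mul, mul_one, mul_zero, zero_mul, Finset.sum_ite_eq, Finset.mem_univ,
    if_true, Finset.sum_mul]
  exact Finset.sum_congr rfl fun c _ => by ring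

theorem ket_eq_single {m i : ℕ} (hi : i < m) :
    ket m i = EuclideanSpace.single (⟨i, hi⟩ : Fin m) (1 : ℂ) := by
  ext a
  simp [ket, Fin.ext_iff]

theorem inner_ket_ket {n i : ℕ} (hi : i < n) (j : ℕ) :
    ⟪ket n i, ket n j⟫ = if i = j then 1 else 0 := by
  rw [ket_eq_single hi, EuclideanSpace.inner_single_left]
  simp [ket]

theorem inner_ket_toEuclideanLin_ket {m i j : ℕ} (B : Matrix (Fin m) (Fin m) ℂ) (hi : i < m)
    (hj : j < m) : ⟪ket m i, Matrix.toEuclideanLin B (ket m j)⟫ = B ⟨i, hi⟩ ⟨j, hj⟩ := by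
  simp [ket_eq_single hi, ket_eq_single hj, EuclideanSpace.inner_single_left]

theorem inner_ket_unif {n p i : ℕ} (hp : p ≤ n) (hi : i < p) : ⟪ket n i, unif n p⟫ = 1 := by
  simp [unif, inner_ket_ket (hi.trans_le hp), hi]

theorem inner_unif_unif {n p : ℕ} (hp : p ≤ n) : ⟪unif n p, unif n p⟫ = (p : ℂ) := by
  conv_lhs => rw [unif.eq_def, sum_inner]
  rw [← unif, Finset.sum_congr rfl fun i hi => inner_ket_unif hp (Finset.mem_range.1 hi)]
  simp

theorem invSqrt2_mul_self : invSqrt2 * invSqrt2 = 1 / 2 := by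
  rw [invSqrt2, ← Complex.ofReal_mul, ← mul_inv, Real.mul_self_sqrt (by norm_num)]
  norm_num

theorem conj_invSqrt2 : (starRingEnd ℂ) invSqrt2 = invSqrt2 :=
  Complex.conj_ofReal _

theorem invSqrt2_ne_zero : invSqrt2 ≠ 0 := by
  simp [invSqrt2]

theorem psi2_of_lt {m n p i : ℕ} (hi : i < p) :
    psi2 m n p i = tp (ket m i) (invSqrt2 • (ket n 0 - ket n i)) :=
  if_pos (by omega)

theorem psi2_add {m n p i : ℕ} (hi : 1 ≤ i) (hip : i < p) :
    psi2 m n p (i + (p - 1)) =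
      tp (invSqrt2 • (ket m 0 - ket m i)) (ket n (jf p i)) := by
  rw [psi2, if_neg (by omega), if_pos (by omega), Nat.add_sub_cancel]

theorem psi2_last {m n p : ℕ} (hp : 1 ≤ p) :
    psi2 m n p (2 * p - 1) = ((p : ℂ))⁻¹ • tp (unif m p) (unif n p) := by
  rw [psi2, if_neg (by omega), if_neg (by omega)]

theorem act_smul {m n : ℕ} (M : Matrix (Fin m × Fin n) (Fin m × Fin n) ℂ) (c : ℂ)
    (x : EuclideanSpace ℂ (Fin m × Fin n)) : act M (c • x) = c • act M x :=
  map_smul (Matrix.toEuclideanLin M) c x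

theorem exists_jf_eq {p i : ℕ} (hp : 3 ≤ p) (hi : 1 ≤ i) (hip : i < p) :
    ∃ l, 1 ≤ l ∧ l < p ∧ l ≠ i ∧ jf p l = i := by
  rcases eq_or_ne i 1 with rfl | hi1
  · exact ⟨p - 1, by omega, by omega, by omega, if_pos rfl⟩
  · exact ⟨i - 1, by omega, by omega, by omega, by rw [jf, if_neg (by omega)]; omega⟩

theorem jf_lt {p i : ℕ} (hp : 3 ≤ p) (hip : i < p) : jf p i < p := by
  rw [jf]; split_ifs <;> omega

theorem alice_measurement_trivial_small_basis (p m n : ℕ) (h3 : 3 ≤ p) (hpm : p ≤ m)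
    (hmn : m ≤ n)
    (B : Matrix (Fin m) (Fin m) ℂ) (hB : B.PosSemidef)
    (h : ∀ k l : ℕ, 1 ≤ k → k ≤ 2 * p - 1 → 1 ≤ l → l ≤ 2 * p - 1 → k ≠ l →
      ⟪psi2 m n p k, act (B ⊗ₖ (1 : Matrix (Fin n) (Fin n) ℂ)) (psi2 m n p l)⟫ = 0) :
    ∀ k, 1 ≤ k → k ≤ 2 * p - 1 →
      ⟪psi2 m n p k, act (B ⊗ₖ (1 : Matrix (Fin n) (Fin n) ℂ)) (psi2 m n p k)⟫ =
        B (⟨0, by omega⟩ : Fin m) (⟨0, by omega⟩ : Fin m) := by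
  set β : ℕ → ℕ → ℂ := fun i j => ⟪ket m i, Matrix.toEuclideanLin B (ket m j)⟫ with hβ
  have hker {i : ℕ} (hi : i < p) (j : ℕ) := inner_ket_ket (hi.trans_le (hpm.trans hmn)) j
  have h0 : 0 < p := by omega
  have inner_psi_psi {i l : ℕ} (hi : 1 ≤ i) (hip : i < p) (hl : 1 ≤ l) :
      ⟪(invSqrt2 • (ket n 0 - ket n i)), (invSqrt2 • (ket n 0 - ket n l))⟫ =
        if i = l then (1 : ℂ) else 1 / 2 := by
    rw [inner_smul_left, inner_smul_right, conj_invSqrt2, ← mul_assoc, invSqrt2_mul_self]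
    simp only [inner_sub_left, inner_sub_right, hker h0, hker hip]
    rw [if_neg (by omega : ¬ 0 = l), if_neg (by omega : ¬ i = 0)]
    split_ifs <;> norm_num
  have off {i l : ℕ} (hi : 1 ≤ i) (hip : i < p) (hl : 1 ≤ l) (hlp : l < p) (hil : i ≠ l) :
      β i l = 0 := by
    have := h i l hi (by omega) hl (by omega) hil
    rw [psi2_of_lt hip, psi2_of_lt hlp, inner_tp_act_kronecker_one, inner_psi_psi hi hip hl,
      if_neg hil] at this
    simpa using this
  have col_zero {i : ℕ} (hi : 1 ≤ i) (hip : i < p) : β i 0 = 0 := by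
    have hi0 : i ≠ 0 := by omega
    obtain ⟨l, hl, hlp, hli, hj⟩ := exists_jf_eq h3 hi hip
    have := h i (l + (p - 1)) hi (by omega) (by omega) (by omega) (by omega)
    rw [psi2_of_lt hip, psi2_add hl hlp, inner_tp_act_kronecker_one, hj] at this
    simp only [map_smul, map_sub, inner_smul_left, inner_smul_right, inner_sub_left,
      inner_sub_right, conj_invSqrt2, hker h0, hker hip] at this
    have hz := off hi hip hl hlp hli.symm
    simp only [hβ] at hz ⊢
    simpa [invSqrt2_ne_zero, hz, hi0.symm] using this
  have row_zero {i : ℕ} (hi : 1 ≤ i) (hip : i < p) : β 0 i = 0 := by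
    have hi0 : i ≠ 0 := by omega
    obtain ⟨l, hl, hlp, hli, hj⟩ := exists_jf_eq h3 hi hip
    have := h (l + (p - 1)) i (by omega) (by omega) hi (by omega) (by omega)
    rw [psi2_of_lt hip, psi2_add hl hlp, inner_tp_act_kronecker_one, hj] at this
    simp only [inner_smul_left, inner_smul_right, inner_sub_left,
      inner_sub_right, conj_invSqrt2, hker hip] at this
    have hz := off hl hlp hi hip hli
    simp only [hβ] at hz ⊢
    simpa [invSqrt2_ne_zero, hz, hi0] using this
  have offdiag {i l : ℕ} (hip : i < p) (hlp : l < p) (hil : i ≠ l) : β i l = 0 := by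
    rcases Nat.eq_zero_or_pos i with rfl | hi
    · exact row_zero (by omega) hlp
    rcases Nat.eq_zero_or_pos l with rfl | hl
    · exact col_zero hi hip
    exact off hi hip hl hlp hil
  have inner_unif {i : ℕ} (hip : i < p) :
      ⟪ket m i, Matrix.toEuclideanLin B (unif m p)⟫ = β i i := by
    rw [unif, map_sum, inner_sum]
    exact Finset.sum_eq_single_of_mem i (Finset.mem_range.2 hip) fun l hl hli =>
      offdiag hip (Finset.mem_range.1 hl) hli.symm
  have diag {i : ℕ} (hip : i < p) : β i i = β 0 0 := by
    rcases Nat.eq_zero_or_pos i with rfl | hi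
    · rfl
    have := h (i + (p - 1)) (2 * p - 1) (by omega) (by omega) (by omega) le_rfl (by omega)
    rw [psi2_add hi hip, psi2_last (by omega), act_smul, inner_smul_right,
      inner_tp_act_kronecker_one, inner_smul_left, inner_sub_left, inner_unif h0, inner_unif hip,
      inner_ket_unif (hpm.trans hmn) (jf_lt h3 hip), conj_invSqrt2] at this
    have hp0 : p ≠ 0 := by omega
    simpa [invSqrt2_ne_zero, hp0, sub_eq_zero, eq_comm (a := β 0 0)] using this
  rw [← inner_ket_toEuclideanLin_ket B (by omega) (by omega)]
  change ∀ k, 1 ≤ k → k ≤ 2 * p - 1 → _ = β 0 0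
  intro k hk hkp
  rcases lt_or_ge k p with hlt | hge
  · rw [psi2_of_lt hlt, inner_tp_act_kronecker_one, inner_psi_psi hk hlt hk, if_pos rfl, mul_one]
    exact diag hlt
  rcases eq_or_ne k (2 * p - 1) with rfl | hne
  · rw [psi2_last (by omega), act_smul, inner_smul_right, inner_smul_left,
      inner_tp_act_kronecker_one, inner_unif_unif (hpm.trans hmn)]
    have hsum : ⟪unif m p, Matrix.toEuclideanLin B (unif m p)⟫ = p * β 0 0 := by
      conv_lhs => rw [unif.eq_def, sum_inner]
      rw [← unif, Finset.sum_congr rfl fun i hi =>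
        (inner_unif (Finset.mem_range.1 hi)).trans (diag (Finset.mem_range.1 hi))]
      simp
    have hp0 : (p : ℂ) ≠ 0 := by exact_mod_cast h0.ne'
    rw [hsum, map_inv₀, Complex.conj_natCast]
    field_simp
  · obtain ⟨i, rfl⟩ : ∃ i, k = i + (p - 1) := ⟨k - (p - 1), by omega⟩
    have hi : 1 ≤ i := by omega
    have hip : i < p := by omega
    have e1 := offdiag h0 hip (by omega)
    have e2 := offdiag hip h0 (by omega)
    have e3 := diag hip
    simp only [hβ] at e1 e2 e3 ⊢
    rw [psi2_add hi hip, inner_tp_act_kronecker_one, map_smul, inner_smul_left, inner_smul_right,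
      conj_invSqrt2, ← mul_assoc, invSqrt2_mul_self, map_sub, inner_sub_left, inner_sub_right,
      inner_sub_right, e1, e2, e3, hker (jf_lt h3 hip), if_pos rfl]
    ring
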